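/- arXiv:2509.20566 — 3 statements merged into one kernel-verified Lean document; each statement's English description precedes it below -/
import Mathlib

section
/- Define f(θ,γ,φ) := (3 + cos 2θ − 8·sin²γ·(cos²γ + sin²γ·sin²φ·cos²φ)·sin⁴(θ/2))/4 for real θ, γ, φ. Then f(θ,γ,φ) ≥ 1/4 for all real θ, γ, φ, with equality attained at θ = 2π/3, γ = arccos(1/√3), φ = π/4. Consequently, for every integer k ≥ 1 and all real θ, γ, φ, one has 1 − f(θ,γ,φ)^k ≤ 1 − (1/4)^k, with equality at the same parameter values. -/
noncomputable section

/-- The single-site factor of the large-`L` Clifford-averaged bipartite A-OTOC for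
Bloch-rotation noise by angle `θ` about axis `(sin γ cos φ, sin γ sin φ, cos γ)`. -/
def fFactor (θ γ φ : ℝ) : ℝ :=
  (3 + Real.cos (2 * θ) -
      8 * Real.sin γ ^ 2 *
        (Real.cos γ ^ 2 + Real.sin γ ^ 2 * Real.sin φ ^ 2 * Real.cos φ ^ 2) *
        Real.sin (θ / 2) ^ 4) / 4

/-- The axis-dependent coefficient is at most `1/3`. -/
lemma axis_coeff_le_third (γ φ : ℝ) :
    Real.sin γ ^ 2 * (Real.cos γ ^ 2 + Real.sin γ ^ 2 * Real.sin φ ^ 2 * Real.cos φ ^ 2) ≤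
      1 / 3 := by
  have hp : Real.sin φ ^ 2 * Real.cos φ ^ 2 ≤ 1 / 4 := by
    rw [Real.cos_sq']
    nlinarith [sq_nonneg (Real.sin φ ^ 2 - 1 / 2)]
  have h := mul_le_mul_of_nonneg_left hp (sq_nonneg (Real.sin γ ^ 2))
  rw [Real.cos_sq' γ]
  nlinarith [sq_nonneg (Real.sin γ ^ 2 - 2 / 3)]

lemma sin_half_pow_four (θ : ℝ) : Real.sin (θ / 2) ^ 4 = (1 - Real.cos θ) ^ 2 / 4 := by
  have h : Real.cos θ = 1 - 2 * Real.sin (θ / 2) ^ 2 := by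
    rw [Real.sin_sq_eq_half_sub, mul_div_cancel₀ θ two_ne_zero]
    ring
  rw [h]
  ring

lemma quarter_le_fFactor (θ γ φ : ℝ) : 1 / 4 ≤ fFactor θ γ φ := by
  have h := mul_le_mul_of_nonneg_right (axis_coeff_le_third γ φ) (sq_nonneg (1 - Real.cos θ))
  unfold fFactor
  rw [sin_half_pow_four, Real.cos_two_mul]
  nlinarith [sq_nonneg (2 * Real.cos θ + 1)]

lemma fFactor_eq_quarter :
    fFactor (2 * Real.pi / 3) (Real.arccos (1 / Real.sqrt 3)) (Real.pi / 4) = 1 / 4 := by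
  have hθ : Real.cos (2 * Real.pi / 3) = -(1 / 2) := by
    rw [show 2 * Real.pi / 3 = Real.pi - Real.pi / 3 by ring, Real.cos_pi_sub,
      Real.cos_pi_div_three]
  have hsqrt : (1 / Real.sqrt 3) ^ 2 = 1 / 3 := by
    rw [div_pow, Real.sq_sqrt (by norm_num)]
    norm_num
  have hγ : Real.cos (Real.arccos (1 / Real.sqrt 3)) = 1 / Real.sqrt 3 :=
    Real.cos_arccos (by nlinarith [show 0 ≤ 1 / Real.sqrt 3 by positivity])
      (by nlinarith [show 0 ≤ 1 / Real.sqrt 3 by positivity])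
  have hφ : (Real.sqrt 2 / 2) ^ 2 = 1 / 2 := by
    rw [div_pow, Real.sq_sqrt (by norm_num)]
    norm_num
  unfold fFactor
  rw [sin_half_pow_four, Real.cos_two_mul, hθ, Real.sin_sq, hγ, hsqrt,
    Real.sin_pi_div_four, Real.cos_pi_div_four, hφ]
  norm_num

/-- `f(θ,γ,φ) ≥ 1/4` everywhere, with equality at
`θ = 2π/3, γ = arccos(1/√3), φ = π/4`; consequently `1 − f^k ≤ 1 − (1/4)^k` for every
`k ≥ 1`, with equality at the same parameter values. -/
theorem fFactor_ge_quarter :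
    (∀ θ γ φ : ℝ, 1 / 4 ≤ fFactor θ γ φ) ∧
    fFactor (2 * Real.pi / 3) (Real.arccos (1 / Real.sqrt 3)) (Real.pi / 4) = 1 / 4 ∧
    (∀ k : ℕ, 1 ≤ k → ∀ θ γ φ : ℝ,
      1 - fFactor θ γ φ ^ k ≤ 1 - (1 / 4 : ℝ) ^ k) ∧
    (∀ k : ℕ, 1 ≤ k →
      1 - fFactor (2 * Real.pi / 3) (Real.arccos (1 / Real.sqrt 3)) (Real.pi / 4) ^ k =
        1 - (1 / 4 : ℝ) ^ k) := by
  refine ⟨quarter_le_fFactor, fFactor_eq_quarter, fun k _ θ γ φ => ?_, fun k _ => ?_⟩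
  · exact sub_le_sub_left (pow_le_pow_left₀ (by norm_num) (quarter_le_fFactor θ γ φ) k) 1
  · rw [fFactor_eq_quarter]
end
end

section
/- Let L be even, d = 2^L, and let V ∈ U(2^L) be unitary. Then the average Pauli-entangling power admits the four-copy trace expression P_E(V) = 1 − (1/d²)·Tr( T^A_{(12)(34)} · (V†)^{⊗4} · Q · V^{⊗4} ), where Q := (1/d²)·Σ_f (P_f)^{⊗4} is the sum over all 4^L Pauli strings of their fourfold Kronecker powers, and T^A_{(12)(34)} is the operator on the four-copy space ((H_A ⊗ H_B))^{⊗4} that swaps the A factors of copies 1 and 2 and swaps the A factors of copies 3 and 4, acting as identity on all four B factors. -/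
open Matrix

noncomputable section

/-- Index type for `L` qubits. -/
abbrev QIdx (L : ℕ) := Fin L → Fin 2

/-- Index type for half of an even chain. -/
abbrev AIdx (m : ℕ) := Fin m → Fin 2

/-- The single-qubit Pauli matrices `σ0 = I, σ1 = X, σ2 = Y, σ3 = Z`. -/
def σP : Fin 4 → Matrix (Fin 2) (Fin 2) ℂ
  | 0 => 1
  | 1 => !![0, 1; 1, 0]
  | 2 => !![0, -Complex.I; Complex.I, 0]
  | 3 => !![1, 0; 0, -1]

/-- The Pauli string `σ_{f 0} ⊗ ⋯ ⊗ σ_{f (L-1)}` as a `2^L × 2^L` matrix. -/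
def PauliString (L : ℕ) (f : Fin L → Fin 4) : Matrix (QIdx L) (QIdx L) ℂ :=
  Matrix.of fun i j => ∏ l, σP (f l) (i l) (j l)

/-- Merge indices of the two halves (A = first m qubits, B = last m qubits). -/
def mergeIdx (m : ℕ) (a b : AIdx m) : QIdx (2 * m) := fun l =>
  if h : (l : ℕ) < m then a ⟨l, h⟩ else b ⟨(l : ℕ) - m, by have := l.isLt; omega⟩

/-- The A-part (first m qubits) of an index. -/
def splitA (m : ℕ) (i : QIdx (2 * m)) : AIdx m := fun a => i ⟨a, by have := a.isLt; omega⟩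

/-- The B-part (last m qubits) of an index. -/
def splitB (m : ℕ) (i : QIdx (2 * m)) : AIdx m := fun b => i ⟨m + b, by have := b.isLt; omega⟩

/-- The realignment `R(O)_{(a,a'),(b,b')} = O_{(a,b),(a',b')}` of a matrix on `L = 2m`
qubits, over the bipartition into the first and last `m` qubits. -/
def realign (m : ℕ) (O : Matrix (QIdx (2 * m)) (QIdx (2 * m)) ℂ) :
    Matrix (AIdx m × AIdx m) (AIdx m × AIdx m) ℂ :=
  Matrix.of fun p q => O (mergeIdx m p.1 q.1) (mergeIdx m p.2 q.2)

/-- Linear operator entanglement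
`E_lin(O) = 1 − Tr([R(O)R(O)†]²)/(Tr[R(O)R(O)†])²` over the symmetric bipartition. -/
def Elin (m : ℕ) (O : Matrix (QIdx (2 * m)) (QIdx (2 * m)) ℂ) : ℂ :=
  1 - Matrix.trace ((realign m O * (realign m O)ᴴ) * (realign m O * (realign m O)ᴴ)) /
        (Matrix.trace (realign m O * (realign m O)ᴴ)) ^ 2

/-- The average Pauli-entangling power `P_E(V) = 4^{−L}·Σ_f E_lin(V†·P_f·V)`. -/
def PE (m : ℕ) (V : Matrix (QIdx (2 * m)) (QIdx (2 * m)) ℂ) : ℂ :=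
  (1 / (4 : ℂ) ^ (2 * m)) *
    ∑ f : Fin (2 * m) → Fin 4, Elin m (Vᴴ * PauliString (2 * m) f * V)

/-- Four-copy index type. -/
abbrev Q4Idx (m : ℕ) := QIdx (2 * m) × QIdx (2 * m) × QIdx (2 * m) × QIdx (2 * m)

/-- The fourfold Kronecker power `M^{⊗4}`. -/
def pow4 (m : ℕ) (M : Matrix (QIdx (2 * m)) (QIdx (2 * m)) ℂ) :
    Matrix (Q4Idx m) (Q4Idx m) ℂ :=
  Matrix.of fun i j =>
    M i.1 j.1 * M i.2.1 j.2.1 * M i.2.2.1 j.2.2.1 * M i.2.2.2 j.2.2.2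

/-- The operator `T^A_{(12)(34)}` swapping the A-factors of copies 1, 2 and of copies 3, 4,
acting as the identity on all four B-factors. -/
def TA1234 (m : ℕ) : Matrix (Q4Idx m) (Q4Idx m) ℂ :=
  Matrix.of fun p q =>
    if p.1 = mergeIdx m (splitA m q.2.1) (splitB m q.1) ∧
       p.2.1 = mergeIdx m (splitA m q.1) (splitB m q.2.1) ∧
       p.2.2.1 = mergeIdx m (splitA m q.2.2.2) (splitB m q.2.2.1) ∧
       p.2.2.2 = mergeIdx m (splitA m q.2.2.1) (splitB m q.2.2.2) then 1 else 0

/-- `Q = (1/d²)·Σ_f P_f^{⊗4}`, summed over all `4^L` Pauli strings. -/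
def Qmat (m : ℕ) : Matrix (Q4Idx m) (Q4Idx m) ℂ :=
  (1 / ((2 : ℂ) ^ (2 * m)) ^ 2) •
    ∑ f : Fin (2 * m) → Fin 4, pow4 m (PauliString (2 * m) f)

/-- Merging the two halves of an index is a bijection. -/
def mergeEquiv (m : ℕ) : AIdx m × AIdx m ≃ QIdx (2 * m) where
  toFun p := mergeIdx m p.1 p.2
  invFun i := (splitA m i, splitB m i)
  left_inv p := by
    ext l <;> simp [mergeIdx, splitA, splitB]
  right_inv i := by
    funext l
    by_cases h : (l : ℕ) < m
    · simp [mergeIdx, splitA, h]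
    · have h' : m + ((l : ℕ) - m) = l := by omega
      simp [mergeIdx, splitB, h, h']

@[simp]
lemma splitA_mergeIdx (m : ℕ) (a b : AIdx m) : splitA m (mergeIdx m a b) = a :=
  congrArg Prod.fst ((mergeEquiv m).left_inv (a, b))

@[simp]
lemma splitB_mergeIdx (m : ℕ) (a b : AIdx m) : splitB m (mergeIdx m a b) = b :=
  congrArg Prod.snd ((mergeEquiv m).left_inv (a, b))

@[simp]
lemma mergeIdx_splitA_splitB (m : ℕ) (i : QIdx (2 * m)) :
    mergeIdx m (splitA m i) (splitB m i) = i :=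
  (mergeEquiv m).right_inv i

lemma sum_qIdx_eq (m : ℕ) (F : QIdx (2 * m) → ℂ) :
    ∑ i, F i = ∑ a, ∑ b, F (mergeIdx m a b) := by
  rw [← (mergeEquiv m).sum_comp, Fintype.sum_prod_type]
  rfl

lemma sum_prod_pi {L : ℕ} {κ : Type*} [Fintype κ] (g : Fin L → κ → ℂ) :
    ∑ f : Fin L → κ, ∏ l, g l (f l) = ∏ l, ∑ s, g l s :=
  (Fintype.prod_sum g).symm

lemma σP_conjTranspose (s : Fin 4) : (σP s)ᴴ = σP s := by
  ext i j
  fin_cases s <;> fin_cases i <;> fin_cases j <;> simp [σP]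

lemma pauliString_conjTranspose (L : ℕ) (f : Fin L → Fin 4) :
    (PauliString L f)ᴴ = PauliString L f := by
  ext i j
  simp only [PauliString, conjTranspose_apply, of_apply, star_prod]
  exact Finset.prod_congr rfl fun l _ => congrFun (congrFun (σP_conjTranspose (f l)) _) _

lemma sum_σP_mul_star (s : Fin 4) : ∑ a, ∑ b, σP s a b * star (σP s a b) = 2 := by
  fin_cases s <;> simp [σP, Fin.sum_univ_two] <;> norm_num

lemma trace_pauliString_mul_conjTranspose (L : ℕ) (f : Fin L → Fin 4) :
    trace (PauliString L f * (PauliString L f)ᴴ) = 2 ^ L := by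
  simp only [trace, diag_apply, mul_apply, conjTranspose_apply, PauliString, of_apply, star_prod,
    ← Finset.prod_mul_distrib]
  simp_rw [fun i : QIdx L => sum_prod_pi fun l b => σP (f l) (i l) b * star (σP (f l) (i l) b)]
  rw [sum_prod_pi fun l a => ∑ b, σP (f l) a b * star (σP (f l) a b)]
  simp only [sum_σP_mul_star, Finset.prod_const, Finset.card_univ, Fintype.card_fin]

/-- Single-qubit version of the invariance of `∑ σ^{⊗4}` under the double transposition
`(12)(34)` of the columns. -/
lemma sum_σP_four_swap (a b c d a' b' c' d' : Fin 2) :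
    ∑ s, σP s a b' * σP s b a' * σP s c d' * σP s d c' =
      ∑ s, σP s a a' * σP s b b' * σP s c c' * σP s d d' := by
  revert a b c d a' b' c' d'
  simp [Fin.forall_fin_two, σP, Fin.sum_univ_four]

/-- The double transposition `(12)(34)` of the four copies. -/
def copySwap (m : ℕ) : Q4Idx m ≃ Q4Idx m where
  toFun q := (q.2.1, q.1, q.2.2.2, q.2.2.1)
  invFun q := (q.2.1, q.1, q.2.2.2, q.2.2.1)
  left_inv _ := rfl
  right_inv _ := rfl

lemma sum_pow4_pauliString_copySwap (m : ℕ) (i j : Q4Idx m) :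
    ∑ f, pow4 m (PauliString (2 * m) f) i (copySwap m j) =
      ∑ f, pow4 m (PauliString (2 * m) f) i j := by
  simp only [pow4, PauliString, of_apply, copySwap, Equiv.coe_fn_mk, ← Finset.prod_mul_distrib]
  rw [sum_prod_pi fun l s => σP s (i.1 l) (j.2.1 l) * σP s (i.2.1 l) (j.1 l) *
      σP s (i.2.2.1 l) (j.2.2.2 l) * σP s (i.2.2.2 l) (j.2.2.1 l),
    sum_prod_pi fun l s => σP s (i.1 l) (j.1 l) * σP s (i.2.1 l) (j.2.1 l) *
      σP s (i.2.2.1 l) (j.2.2.1 l) * σP s (i.2.2.2 l) (j.2.2.2 l)]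
  exact Finset.prod_congr rfl fun l _ => sum_σP_four_swap ..

lemma pow4_mul (m : ℕ) (M N : Matrix (QIdx (2 * m)) (QIdx (2 * m)) ℂ) :
    pow4 m (M * N) = pow4 m M * pow4 m N := by
  ext i j
  simp only [pow4, mul_apply, of_apply, Fintype.sum_prod_type, mul_assoc, Finset.sum_mul]
  simp only [Finset.mul_sum]
  refine Finset.sum_congr rfl fun _ _ => Finset.sum_congr rfl fun _ _ =>
    Finset.sum_congr rfl fun _ _ => Finset.sum_congr rfl fun _ _ => ?_
  ring

lemma pow4_copySwap (m : ℕ) (M : Matrix (QIdx (2 * m)) (QIdx (2 * m)) ℂ) (i j : Q4Idx m) :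
    pow4 m M (copySwap m i) (copySwap m j) = pow4 m M i j := by
  simp only [pow4, of_apply, copySwap, Equiv.coe_fn_mk]
  ring

/-- The sum of the fourfold powers of the rotated Pauli strings is invariant under the double
transposition `(12)(34)` of its columns. -/
lemma sum_pow4_rotated_copySwap (m : ℕ) (W V : Matrix (QIdx (2 * m)) (QIdx (2 * m)) ℂ)
    (i j : Q4Idx m) :
    ∑ f, pow4 m (W * PauliString (2 * m) f * V) i (copySwap m j) =
      ∑ f, pow4 m (W * PauliString (2 * m) f * V) i j := by
  have key (k : Q4Idx m) : ∑ f, pow4 m (W * PauliString (2 * m) f) i (copySwap m k) =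
      ∑ f, pow4 m (W * PauliString (2 * m) f) i k := by
    simp only [pow4_mul, mul_apply]
    rw [Finset.sum_comm, Finset.sum_comm (s := Finset.univ (α := Fin (2 * m) → Fin 4))]
    simp only [← Finset.mul_sum, sum_pow4_pauliString_copySwap]
  have expand (j : Q4Idx m) : ∑ f, pow4 m (W * PauliString (2 * m) f * V) i j =
      ∑ k, (∑ f, pow4 m (W * PauliString (2 * m) f) i k) * pow4 m V k j := by
    simp only [pow4_mul m _ V, mul_apply (N := pow4 m V), Finset.sum_mul]
    exact Finset.sum_comm
  rw [expand, expand, ← (copySwap m).sum_comp]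
  simp only [key, pow4_copySwap]

lemma trace_realign_mul_conjTranspose (m : ℕ) (O : Matrix (QIdx (2 * m)) (QIdx (2 * m)) ℂ) :
    trace (realign m O * (realign m O)ᴴ) = trace (O * Oᴴ) := by
  simp only [trace, diag_apply, mul_apply, conjTranspose_apply, realign, of_apply,
    Fintype.sum_prod_type, sum_qIdx_eq]
  refine Finset.sum_congr rfl fun a _ => ?_
  rw [Finset.sum_comm]

lemma trace_rotated (m : ℕ) (V : Matrix (QIdx (2 * m)) (QIdx (2 * m)) ℂ)
    (hV : V ∈ Matrix.unitaryGroup (QIdx (2 * m)) ℂ) (f : Fin (2 * m) → Fin 4) :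
    trace ((Vᴴ * PauliString (2 * m) f * V) * (Vᴴ * PauliString (2 * m) f * V)ᴴ) =
      2 ^ (2 * m) := by
  have h : V * Vᴴ = 1 := mem_unitaryGroup_iff.1 hV
  rw [← trace_pauliString_mul_conjTranspose (2 * m) f]
  have e : (Vᴴ * PauliString (2 * m) f * V) * (Vᴴ * PauliString (2 * m) f * V)ᴴ =
      Vᴴ * (PauliString (2 * m) f * (PauliString (2 * m) f)ᴴ * V) := by
    simp only [conjTranspose_mul, conjTranspose_conjTranspose, Matrix.mul_assoc]
    rw [← Matrix.mul_assoc V Vᴴ, h, Matrix.one_mul]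
  rw [e, trace_mul_comm, Matrix.mul_assoc, h, Matrix.mul_one]

/-- Regrouping of the eight half-chain indices in `Tr([R(O)R(O)†]²)` into four full indices. -/
def regroupEquiv (m : ℕ) :
    ((AIdx m × AIdx m) × (AIdx m × AIdx m) × (AIdx m × AIdx m) × (AIdx m × AIdx m)) ≃
      Q4Idx m where
  toFun x := (mergeIdx m x.1.1 x.2.2.1.1, mergeIdx m x.2.1.2 x.2.2.1.2,
    mergeIdx m x.2.1.1 x.2.2.2.1, mergeIdx m x.1.2 x.2.2.2.2)
  invFun q := ((splitA m q.1, splitA m q.2.2.2), (splitA m q.2.2.1, splitA m q.2.1),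
    (splitB m q.1, splitB m q.2.1), (splitB m q.2.2.1, splitB m q.2.2.2))
  left_inv _ := by simp
  right_inv _ := by simp

/-- Fourth moment of the realignment of a Hermitian matrix, in four-copy form. -/
lemma trace_realign_four (m : ℕ) (O : Matrix (QIdx (2 * m)) (QIdx (2 * m)) ℂ) (hO : Oᴴ = O) :
    trace ((realign m O * (realign m O)ᴴ) * (realign m O * (realign m O)ᴴ)) =
      ∑ q : Q4Idx m, pow4 m O q (copySwap m
        (mergeIdx m (splitA m q.2.2.1) (splitB m q.1), mergeIdx m (splitA m q.2.2.2) (splitB m q.2.1),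
         mergeIdx m (splitA m q.1) (splitB m q.2.2.1),
         mergeIdx m (splitA m q.2.1) (splitB m q.2.2.2))) := by
  have hs (i j : QIdx (2 * m)) : star (O i j) = O j i := congrFun (congrFun hO j) i
  rw [← (regroupEquiv m).sum_comp]
  simp only [regroupEquiv, Equiv.coe_fn_mk, splitA_mergeIdx, splitB_mergeIdx, pow4, copySwap,
    of_apply, trace, diag_apply, mul_apply, conjTranspose_apply, realign, hs]
  simp only [Finset.sum_mul_sum, Fintype.sum_prod_type (α₁ := AIdx m × AIdx m)]
  refine Finset.sum_congr rfl fun _ _ => Finset.sum_congr rfl fun _ _ =>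
    Finset.sum_congr rfl fun _ _ => Finset.sum_congr rfl fun _ _ => ?_
  ring

lemma trace_TA1234_mul (m : ℕ) (M : Matrix (Q4Idx m) (Q4Idx m) ℂ) :
    trace (TA1234 m * M) = ∑ q : Q4Idx m, M q
      (mergeIdx m (splitA m q.2.1) (splitB m q.1), mergeIdx m (splitA m q.1) (splitB m q.2.1),
       mergeIdx m (splitA m q.2.2.2) (splitB m q.2.2.1),
       mergeIdx m (splitA m q.2.2.1) (splitB m q.2.2.2)) := by
  have hT (p q : Q4Idx m) : TA1234 m p q = if p =
      (mergeIdx m (splitA m q.2.1) (splitB m q.1), mergeIdx m (splitA m q.1) (splitB m q.2.1),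
       mergeIdx m (splitA m q.2.2.2) (splitB m q.2.2.1),
       mergeIdx m (splitA m q.2.2.1) (splitB m q.2.2.2)) then 1 else 0 := by
    simp only [TA1234, of_apply, Prod.ext_iff]
  rw [trace_mul_comm]
  simp [trace, mul_apply, hT]

/-- Exchange of the second and third copies. -/
def copyExchange (m : ℕ) : Q4Idx m ≃ Q4Idx m where
  toFun q := (q.1, q.2.2.1, q.2.1, q.2.2.2)
  invFun q := (q.1, q.2.2.1, q.2.1, q.2.2.2)
  left_inv _ := rfl
  right_inv _ := rfl

lemma pow4_copyExchange (m : ℕ) (M : Matrix (QIdx (2 * m)) (QIdx (2 * m)) ℂ) (i j : Q4Idx m) :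
    pow4 m M (copyExchange m i) (copyExchange m j) = pow4 m M i j := by
  simp only [pow4, of_apply, copyExchange, Equiv.coe_fn_mk]
  ring

lemma sum_trace_realign_four (m : ℕ) (V : Matrix (QIdx (2 * m)) (QIdx (2 * m)) ℂ) :
    ∑ f, trace ((realign m (Vᴴ * PauliString (2 * m) f * V) *
        (realign m (Vᴴ * PauliString (2 * m) f * V))ᴴ) *
        (realign m (Vᴴ * PauliString (2 * m) f * V) *
        (realign m (Vᴴ * PauliString (2 * m) f * V))ᴴ)) =
      ∑ f, trace (TA1234 m * pow4 m (Vᴴ * PauliString (2 * m) f * V)) := by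
  have hO (f : Fin (2 * m) → Fin 4) :
      (Vᴴ * PauliString (2 * m) f * V)ᴴ = Vᴴ * PauliString (2 * m) f * V := by
    simp only [conjTranspose_mul, conjTranspose_conjTranspose, pauliString_conjTranspose,
      Matrix.mul_assoc]
  simp only [trace_realign_four m _ (hO _), trace_TA1234_mul]
  rw [Finset.sum_comm, Finset.sum_comm (s := Finset.univ (α := Fin (2 * m) → Fin 4))]
  simp only [sum_pow4_rotated_copySwap]
  rw [← (copyExchange m).sum_comp]
  exact Finset.sum_congr rfl fun q _ => Finset.sum_congr rfl fun f _ =>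
    pow4_copyExchange m _ q (_, _, _, _)

/-- For any unitary `V` on an even number `L = 2m` of qubits, the average
Pauli-entangling power admits the four-copy trace expression
`P_E(V) = 1 − (1/d²)·Tr(T^A_{(12)(34)}·(V†)^{⊗4}·Q·V^{⊗4})`. -/
theorem APEP_four_copy_formula
    (m : ℕ) (V : Matrix (QIdx (2 * m)) (QIdx (2 * m)) ℂ)
    (hV : V ∈ Matrix.unitaryGroup (QIdx (2 * m)) ℂ) :
    PE m V =
      1 - (1 / ((2 : ℂ) ^ (2 * m)) ^ 2) *
        Matrix.trace (TA1234 m * pow4 m Vᴴ * Qmat m * pow4 m V) := by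
  have hd : (4 : ℂ) ^ (2 * m) = ((2 : ℂ) ^ (2 * m)) ^ 2 := by
    rw [← pow_mul, mul_comm (2 * m) 2, pow_mul (2 : ℂ) 2 (2 * m)]
    norm_num only
  have h0 : ((2 : ℂ) ^ (2 * m)) ^ 2 ≠ 0 := pow_ne_zero _ (pow_ne_zero _ two_ne_zero)
  have hR : trace (TA1234 m * pow4 m Vᴴ * Qmat m * pow4 m V) =
      1 / ((2 : ℂ) ^ (2 * m)) ^ 2 *
        ∑ f, trace (TA1234 m * pow4 m (Vᴴ * PauliString (2 * m) f * V)) := by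
    simp only [Qmat, pow4_mul, Matrix.mul_smul, Matrix.smul_mul, trace_smul, smul_eq_mul,
      Matrix.mul_sum, Matrix.sum_mul, trace_sum, Matrix.mul_assoc]
  rw [hR, ← sum_trace_realign_four, PE, hd]
  simp only [Elin, trace_realign_mul_conjTranspose, trace_rotated m V hV,
    Finset.sum_sub_distrib, ← Finset.sum_div, Finset.sum_const, Finset.card_univ,
    Fintype.card_pi, Fintype.card_fin, Finset.prod_const, nsmul_eq_mul, mul_one]
  push_cast
  rw [hd, mul_sub, one_div_mul_cancel h0]
  ring
end
end

section
/- Let L ≥ 1. Then Σ_{f : Fin L → Fin 4} (P_f)^{⊗4} = (1/1)·reindex of Λ^{⊗L}: precisely, the fourfold Kronecker power of each Pauli string, summed over all 4^L Pauli strings, equals the L-fold Kronecker product Λ ⊗ Λ ⊗ ⋯ ⊗ Λ after conjugating by the canonical permutation of tensor factors identifying ((ℂ²)^{⊗L})^{⊗4} with ((ℂ²)^{⊗4})^{⊗L} (grouping together the i-th qubit of each of the four copies, for i = 1,…,L). -/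
open Matrix

noncomputable section

/-- The fourfold Kronecker power `M^{⊗4}`, on the four-copy space `((ℂ²)^{⊗L})^{⊗4}`. -/
def pow4F (L : ℕ) (M : Matrix (QIdx L) (QIdx L) ℂ) :
    Matrix (Fin 4 → QIdx L) (Fin 4 → QIdx L) ℂ :=
  Matrix.of fun i j => ∏ c, M (i c) (j c)

/-- `Λ = Σ_{j=0}^{3} σ_j ⊗ σ_j ⊗ σ_j ⊗ σ_j`, a `16×16` matrix on `(ℂ²)^{⊗4}`. -/
def ΛF : Matrix (Fin 4 → Fin 2) (Fin 4 → Fin 2) ℂ :=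
  Matrix.of fun i j => ∑ t : Fin 4, ∏ c, σP t (i c) (j c)

/-- The `L`-fold Kronecker power `Λ^{⊗L}` on `((ℂ²)^{⊗4})^{⊗L}`. -/
def ΛpowL (L : ℕ) :
    Matrix (Fin L → Fin 4 → Fin 2) (Fin L → Fin 4 → Fin 2) ℂ :=
  Matrix.of fun i j => ∏ l, ΛF (i l) (j l)

/-- The sum over all `4^L` Pauli strings of their fourfold Kronecker
powers equals `Λ^{⊗L}`, after conjugating by the canonical permutation of tensor factors
identifying `((ℂ²)^{⊗L})^{⊗4}` with `((ℂ²)^{⊗4})^{⊗L}`. -/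
theorem sum_pauli_pow4_eq_lambda (L : ℕ) (hL : 1 ≤ L) :
    ∑ f : Fin L → Fin 4, pow4F L (PauliString L f) =
      Matrix.reindex
        (Equiv.piComm fun (_ : Fin L) (_ : Fin 4) => Fin 2)
        (Equiv.piComm fun (_ : Fin L) (_ : Fin 4) => Fin 2)
        (ΛpowL L) := by
  ext i j
  rw [Matrix.sum_apply]
  change ∑ f : Fin L → Fin 4, ∏ c, ∏ l, σP (f l) (i c l) (j c l) =
    ∏ l, ∑ t : Fin 4, ∏ c, σP t (i c l) (j c l)
  rw [Fintype.prod_sum]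
  exact Finset.sum_congr rfl fun f _ => Finset.prod_comm
end
end
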